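/- Let b, T > 0, let U_b : [0,T] → ℝ be continuous, and let u : [0,T] × [0,b] → ℝ be continuously differentiable. For each t, let ũ(t,·) be the radial average of u(t,·) (extended by ũ(t,0) = u(t,0)), define g(t,r) := exp(−∫_r^b (1/s)(u(t,s) − ũ(t,s))² ds), and let g̃(t,·) be the radial average of g(t,·). Assume that for all (t,r) ∈ (0,T) × (0,b): u_t(t,r) = ∂_r( (1/2)·g̃(t,r)·u(t,r) ) − (1/2)·g̃_r(t,r)·ũ(t,r), and that u(t,b) = U_b(t) for all t. Then for every t ∈ (0,T): (1/2)·(d/dt)∫_0^b u(t,r)² dr + (1/4)·g(t,0)·u(t,0)² ≤ (1/4)·U_b(t)² + (1/4)·(1 − g(t,0)). -/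

import Mathlib

open MeasureTheory intervalIntegral

/-- The radial average of a function continuous on `[0, b]` satisfies `(f̃)' = (f - f̃) / r`. -/
lemma hasDerivAt_radialAverage {b r : ℝ} {f a : ℝ → ℝ} (hf : ContinuousOn f (Set.Icc 0 b))
    (ha : ∀ r ∈ Set.Ioc 0 b, a r = (1 / r) * ∫ s in (0:ℝ)..r, f s) (hr : r ∈ Set.Ioo 0 b) :
    HasDerivAt a ((f r - a r) / r) r := by
  have hr0 : r ≠ 0 := hr.1.ne'
  have hnhds : Set.Icc 0 b ∈ nhds r := Icc_mem_nhds hr.1 hr.2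
  have hint : IntervalIntegrable f volume 0 r :=
    (hf.mono (by
      rw [Set.uIcc_of_le hr.1.le]
      exact Set.Icc_subset_Icc_right hr.2.le)).intervalIntegrable
  have hmeas : StronglyMeasurableAtFilter f (nhds r) :=
    ⟨Set.Icc 0 b, hnhds, hf.aestronglyMeasurable measurableSet_Icc⟩
  have h1 := integral_hasDerivAt_right hint hmeas (hf.continuousAt hnhds)
  have h2 : HasDerivAt (fun x : ℝ => (1 / x) * ∫ s in (0:ℝ)..x, f s) ((f r - a r) / r) r := by
    have h3 : HasDerivAt (fun x : ℝ => 1 / x) (-(r ^ 2)⁻¹) r := by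
      simpa only [one_div] using hasDerivAt_inv hr0
    refine (h3.mul h1).congr_deriv ?_
    rw [ha r ⟨hr.1, hr.2.le⟩]
    field_simp
    ring
  refine h2.congr_of_eventuallyEq ?_
  filter_upwards [Ioo_mem_nhds hr.1 hr.2] with x hx
  exact ha x ⟨hx.1, hx.2.le⟩

lemma continuousOn_radialAverage {b : ℝ} (hb : 0 < b) {f a : ℝ → ℝ}
    (hf : ContinuousOn f (Set.Icc 0 b))
    (ha : ∀ r ∈ Set.Ioc 0 b, a r = (1 / r) * ∫ s in (0:ℝ)..r, f s) :
    ContinuousOn a (Set.Ioc 0 b) := by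
  have h1 : ContinuousOn (fun x => ∫ s in (0:ℝ)..x, f s) (Set.Icc 0 b) := by
    have := continuousOn_primitive_interval (μ := volume) (f := f) (a := 0) (b := b)
      (by rw [Set.uIcc_of_le hb.le]; exact hf.integrableOn_Icc)
    rwa [Set.uIcc_of_le hb.le] at this
  have h2 : ContinuousOn (fun x : ℝ => 1 / x) (Set.Ioc 0 b) :=
    continuousOn_const.div continuousOn_id fun x hx => hx.1.ne'
  exact (h2.mul (h1.mono Set.Ioc_subset_Icc_self)).congr ha

/-- The radial average at `r` lies in any interval `[c, d]` containing the values on `[0, r]`. -/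
lemma radialAverage_mem_Icc {r c d : ℝ} {f : ℝ → ℝ} (hr : 0 < r)
    (hf : ContinuousOn f (Set.Icc 0 r)) (hcd : ∀ s ∈ Set.Icc 0 r, f s ∈ Set.Icc c d) :
    (1 / r) * ∫ s in (0:ℝ)..r, f s ∈ Set.Icc c d := by
  have hint : IntervalIntegrable f volume 0 r := by
    refine ContinuousOn.intervalIntegrable ?_
    rwa [Set.uIcc_of_le hr.le]
  have h1 := integral_mono_on hr.le (intervalIntegrable_const (c := c)) hint
    fun s hs => (hcd s hs).1
  have h2 := integral_mono_on hr.le hint (intervalIntegrable_const (c := d))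
    fun s hs => (hcd s hs).2
  rw [intervalIntegral.integral_const, smul_eq_mul, sub_zero] at h1 h2
  rw [one_div, inv_mul_eq_div]
  exact ⟨(le_div_iff₀ hr).2 (by linarith), (div_le_iff₀ hr).2 (by linarith)⟩

lemma abs_sub_radialAverage_le {r K : ℝ} {f : ℝ → ℝ} (hr : 0 < r) (hK : 0 ≤ K)
    (hf : ContinuousOn f (Set.Icc 0 r))
    (hlip : ∀ s ∈ Set.Icc 0 r, |f s - f r| ≤ K * |s - r|) :
    |f r - (1 / r) * ∫ s in (0:ℝ)..r, f s| ≤ K * r := by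
  have h := radialAverage_mem_Icc (c := f r - K * r) (d := f r + K * r) hr hf fun s hs => by
    have h1 := hlip s hs
    have h2 : K * |s - r| ≤ K * r := by
      gcongr
      rw [abs_le]
      constructor <;> linarith [hs.1, hs.2]
    have h3 := abs_le.1 (h1.trans h2)
    exact ⟨by linarith, by linarith⟩
  rw [abs_le]
  exact ⟨by linarith [h.2], by linarith [h.1]⟩

lemma integrableOn_sq_sub_radialAverage_div {b : ℝ} (hb : 0 < b) {v m : ℝ → ℝ}
    (hv : ContDiffOn ℝ 1 v (Set.Icc 0 b))
    (hm : ∀ r ∈ Set.Ioc 0 b, m r = (1 / r) * ∫ s in (0:ℝ)..r, v s) :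
    IntegrableOn (fun s => (1 / s) * (v s - m s) ^ 2) (Set.Icc 0 b) := by
  obtain ⟨K, hK⟩ := hv.exists_lipschitzOnWith one_ne_zero (convex_Icc 0 b) isCompact_Icc
  have hcont : ContinuousOn (fun s => (1 / s) * (v s - m s) ^ 2) (Set.Ioc 0 b) :=
    (continuousOn_const.div continuousOn_id fun x hx => hx.1.ne').mul
      (((hv.continuousOn.mono Set.Ioc_subset_Icc_self).sub
        (continuousOn_radialAverage hb hv.continuousOn hm)).pow 2)
  rw [integrableOn_Icc_iff_integrableOn_Ioc]
  refine IntegrableOn.of_bound measure_Ioc_lt_top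
    (hcont.aestronglyMeasurable measurableSet_Ioc) ((K : ℝ) ^ 2 * b) ?_
  refine (ae_restrict_iff' measurableSet_Ioc).2 (Filter.Eventually.of_forall fun s hs => ?_)
  have h1 : |v s - m s| ≤ K * s := by
    rw [hm s hs]
    refine abs_sub_radialAverage_le hs.1 K.2
      (hv.continuousOn.mono (Set.Icc_subset_Icc_right hs.2)) fun x hx => ?_
    simpa only [Real.dist_eq] using
      hK.dist_le_mul x ⟨hx.1, hx.2.trans hs.2⟩ s ⟨hs.1.le, hs.2⟩
  have h2 : (v s - m s) ^ 2 ≤ (K * s) ^ 2 := by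
    rw [← sq_abs]
    gcongr
  have hs0 := hs.1
  rw [Real.norm_eq_abs, abs_of_nonneg (by positivity)]
  calc (1 / s) * (v s - m s) ^ 2 ≤ (1 / s) * (K * s) ^ 2 := by gcongr
    _ = (K : ℝ) ^ 2 * s := by field_simp
    _ ≤ (K : ℝ) ^ 2 * b := by gcongr; exact hs.2

/-- The energy inequality on a single time slice, with `p` playing the role of `u_t`. -/
lemma integral_mul_le_of_bondi_slice {b : ℝ} (hb : 0 < b) {v m G A p : ℝ → ℝ}
    (hv : ContDiffOn ℝ 1 v (Set.Icc 0 b))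
    (hm : ∀ r ∈ Set.Ioc 0 b, m r = (1 / r) * ∫ s in (0:ℝ)..r, v s)
    (hG : ∀ r ∈ Set.Icc 0 b, G r = Real.exp (-(∫ s in r..b, (1 / s) * (v s - m s) ^ 2)))
    (hA : ∀ r ∈ Set.Ioc 0 b, A r = (1 / r) * ∫ s in (0:ℝ)..r, G s)
    (hp : ContinuousOn p (Set.Icc 0 b))
    (hpde : ∀ r ∈ Set.Ioo 0 b,
      p r = deriv (fun x => (1 / 2) * A x * v x) r - (1 / 2) * deriv A r * m r) :
    (∫ r in (0:ℝ)..b, v r * p r)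
      ≤ (1 / 4) * (v b ^ 2 + 1) - (1 / 4) * (G 0 * v 0 ^ 2 + G 0) := by
  have hq := integrableOn_sq_sub_radialAverage_div hb hv hm
  set q : ℝ → ℝ := fun s => (1 / s) * (v s - m s) ^ 2 with hqdef
  have hqint : IntervalIntegrable q volume 0 b := by
    rwa [intervalIntegrable_iff_integrableOn_Icc_of_le hb.le]
  have hqsub : ∀ x ∈ Set.Icc 0 b, ∀ y ∈ Set.Icc 0 b, IntervalIntegrable q volume x y := by
    intro x hx y hy
    refine hqint.mono_set ?_
    rw [Set.uIcc_of_le hb.le]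
    exact Set.uIcc_subset_Icc hx hy
  have hGcont : ContinuousOn G (Set.Icc 0 b) := by
    have h := continuousOn_primitive_interval_left (μ := volume) (f := q) (a := 0) (b := b)
      (by rwa [Set.uIcc_of_le hb.le])
    rw [Set.uIcc_of_le hb.le] at h
    exact (Real.continuous_exp.comp_continuousOn h.neg).congr hG
  have hb_mem : b ∈ Set.Icc 0 b := Set.right_mem_Icc.2 hb.le
  have h0_mem : (0:ℝ) ∈ Set.Icc 0 b := Set.left_mem_Icc.2 hb.le
  have hGmono : MonotoneOn G (Set.Icc 0 b) := by
    intro x hx y hy hxy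
    rw [hG x hx, hG y hy, Real.exp_le_exp, neg_le_neg_iff,
      ← integral_add_adjacent_intervals (hqsub x hx y hy) (hqsub y hy b hb_mem)]
    have : 0 ≤ ∫ s in x..y, q s := integral_nonneg hxy fun s hs => by
      have := hx.1.trans hs.1
      positivity
    linarith
  have hGpos : ∀ r ∈ Set.Icc 0 b, 0 < G r := fun r hr => by
    rw [hG r hr]
    exact Real.exp_pos _
  have hGb : G b = 1 := by simp [hG b hb_mem]
  have hAmem : ∀ r ∈ Set.Ioc 0 b, A r ∈ Set.Icc (G 0) (G r) := by
    intro r hr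
    rw [hA r hr]
    have hsub : Set.Icc 0 r ⊆ Set.Icc 0 b := Set.Icc_subset_Icc_right hr.2
    exact radialAverage_mem_Icc hr.1 (hGcont.mono hsub) fun s hs =>
      ⟨hGmono h0_mem (hsub hs) hs.1, hGmono (hsub hs) ⟨hr.1.le, hr.2⟩ hs.2⟩
  set B : ℝ → ℝ := Function.update A 0 (G 0) with hB
  have hB0 : B 0 = G 0 := Function.update_self ..
  have hBA : ∀ r ∈ Set.Ioc 0 b, B r = A r := fun r hr => Function.update_of_ne hr.1.ne' _ _
  have hBmem : ∀ r ∈ Set.Icc 0 b, B r ∈ Set.Icc (G 0) (G r) := by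
    intro r hr
    rcases hr.1.eq_or_lt with rfl | h
    · rw [hB0]
      exact ⟨le_rfl, le_rfl⟩
    · rw [hBA r ⟨h, hr.2⟩]
      exact hAmem r ⟨h, hr.2⟩
  have hBcont : ContinuousOn B (Set.Icc 0 b) := by
    intro r hr
    rcases hr.1.eq_or_lt with rfl | h
    · refine tendsto_of_tendsto_of_tendsto_of_le_of_le' (g := fun _ => G 0) (h := G) ?_ ?_ ?_ ?_
      · rw [hB0]
        exact tendsto_const_nhds
      · rw [hB0]
        exact hGcont 0 h0_mem
      · filter_upwards [self_mem_nhdsWithin] with x hx using (hBmem x hx).1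
      · filter_upwards [self_mem_nhdsWithin] with x hx using (hBmem x hx).2
    · have h1 : ContinuousWithinAt B (Set.Ioc 0 b) r :=
        (continuousOn_radialAverage hb hGcont hA).congr hBA r ⟨h, hr.2⟩
      refine h1.mono_of_mem_nhdsWithin ?_
      filter_upwards [self_mem_nhdsWithin, mem_nhdsWithin_of_mem_nhds (Ioi_mem_nhds h)]
        with x hx hx' using ⟨hx', hx.2⟩
  have hF := integral_le_sub_of_hasDeriv_right_of_le hb.le
    (g := fun r => (1 / 4) * (B r * v r ^ 2 + G r))
    (g' := fun r => (1 / 4) * ((G r - A r) / r * v r ^ 2 + A r * (2 * v r * deriv v r)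
      + G r * q r))
    (φ := fun r => v r * p r)
    (continuousOn_const.mul ((hBcont.mul (hv.continuousOn.pow 2)).add hGcont))
    ?_ (hv.continuousOn.mul hp).integrableOn_Icc ?_
  · have hAb : A b ≤ 1 := hGb ▸ (hAmem b ⟨hb, le_rfl⟩).2
    simp only [hB0, hBA b ⟨hb, le_rfl⟩, hGb] at hF
    nlinarith [mul_le_mul_of_nonneg_right hAb (sq_nonneg (v b))]
  all_goals
    intro r hr
    have hr' : r ∈ Set.Ioc 0 b := ⟨hr.1, hr.2.le⟩
    have hnhds : Set.Icc 0 b ∈ nhds r := Icc_mem_nhds hr.1 hr.2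
    have hdA := hasDerivAt_radialAverage hGcont hA hr
    have hdv : HasDerivAt v (deriv v r) r :=
      ((hv.contDiffAt hnhds).differentiableAt one_ne_zero).hasDerivAt
  · have hdB : HasDerivAt B ((G r - A r) / r) r := by
      refine hdA.congr_of_eventuallyEq ?_
      filter_upwards [Ioo_mem_nhds hr.1 hr.2] with x hx
      exact hBA x ⟨hx.1, hx.2.le⟩
    have hqcont : ContinuousAt q r :=
      (continuousAt_const.div continuousAt_id hr.1.ne').mul
        ((hdv.continuousAt.sub (hasDerivAt_radialAverage hv.continuousOn hm hr).continuousAt).pow 2)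
    have hdq := integral_hasDerivAt_left (hqsub r ⟨hr.1.le, hr.2.le⟩ b hb_mem)
      ⟨Set.Icc 0 b, hnhds, hq.aestronglyMeasurable⟩ hqcont
    have hdG : HasDerivAt G (G r * q r) r := by
      have h := hdq.neg.exp.congr_of_eventuallyEq (f₁ := G) (by
        filter_upwards [hnhds] with x hx using hG x hx)
      refine h.congr_deriv ?_
      rw [neg_neg, hG r ⟨hr.1.le, hr.2.le⟩, Pi.neg_apply]
    have h := ((hdB.mul (hdv.pow 2)).add hdG).const_mul (1 / 4 : ℝ)
    rw [hBA r hr'] at h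
    refine (h.congr_deriv ?_).hasDerivWithinAt
    norm_num
  · have hd : HasDerivAt (fun x => (1 / 2) * A x * v x)
        ((1 / 2) * ((G r - A r) / r) * v r + (1 / 2) * A r * deriv v r) r :=
      (hdA.const_mul (1 / 2 : ℝ)).mul hdv
    have hAr := hAmem r hr'
    have hA0 : 0 ≤ A r := (hGpos 0 h0_mem).le.trans hAr.1
    have hd0 : 0 ≤ (G r - A r) / r := div_nonneg (sub_nonneg.2 hAr.2) hr.1.le
    have hq0 : 0 ≤ q r := mul_nonneg (one_div_nonneg.2 hr.1.le) (sq_nonneg _)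
    have hkey : G r * q r = (G r - A r) / r * (v r - m r) ^ 2 + A r * q r := by
      simp only [hqdef]
      ring
    rw [hpde r hr, hd.deriv, hdA.deriv, hkey]
    nlinarith [mul_nonneg hd0 (sq_nonneg (m r)), mul_nonneg hA0 hq0]

/-- Differentiation under the integral for a function that is `C¹` on a closed rectangle. -/
lemma exists_hasDerivAt_integral_sq {b T t : ℝ} (hb : 0 < b) (hT : 0 < T) {u : ℝ → ℝ → ℝ}
    (hu : ContDiffOn ℝ 1 (fun p : ℝ × ℝ => u p.1 p.2) (Set.Icc 0 T ×ˢ Set.Icc 0 b))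
    (ht : t ∈ Set.Ioo 0 T) :
    ∃ p : ℝ → ℝ, ContinuousOn p (Set.Icc 0 b) ∧
      (∀ r ∈ Set.Icc 0 b, HasDerivAt (fun τ => u τ r) (p r) t) ∧
      HasDerivAt (fun τ => ∫ r in (0:ℝ)..b, u τ r ^ 2) (2 * ∫ r in (0:ℝ)..b, u t r * p r) t := by
  set S : Set (ℝ × ℝ) := Set.Icc 0 T ×ˢ Set.Icc 0 b with hS
  set f : ℝ × ℝ → ℝ := fun p => u p.1 p.2 with hf
  set w : ℝ × ℝ → ℝ := fun x => fderivWithin ℝ f S x (1, 0) with hw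
  have hSu : UniqueDiffOn ℝ S := (uniqueDiffOn_Icc hT).prod (uniqueDiffOn_Icc hb)
  have hwcont : ContinuousOn w S :=
    (hu.continuousOn_fderivWithin hSu le_rfl).clm_apply continuousOn_const
  have hfcont : ContinuousOn f S := hu.continuousOn
  have hderiv : ∀ τ ∈ Set.Ioo 0 T, ∀ r ∈ Set.Icc 0 b,
      HasDerivAt (fun τ => u τ r) (w (τ, r)) τ := by
    intro τ hτ r hr
    have h1 : HasFDerivWithinAt f (fderivWithin ℝ f S (τ, r)) S (τ, r) :=
      (hu.differentiableOn one_ne_zero (τ, r) ⟨⟨hτ.1.le, hτ.2.le⟩, hr⟩).hasFDerivWithinAt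
    have h2 : HasDerivWithinAt (fun σ : ℝ => (σ, r)) ((1 : ℝ), (0 : ℝ)) (Set.Icc 0 T) τ :=
      ((hasDerivAt_id τ).prodMk (hasDerivAt_const τ r)).hasDerivWithinAt
    exact (h1.comp_hasDerivWithinAt (t := S) τ h2 fun σ hσ => ⟨hσ, hr⟩).hasDerivAt
      (Icc_mem_nhds hτ.1 hτ.2)
  have hslice : ∀ τ ∈ Set.Icc 0 T, ∀ F : ℝ × ℝ → ℝ, ContinuousOn F S →
      ContinuousOn (fun r => F (τ, r)) (Set.Icc 0 b) := fun τ hτ F hF =>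
    hF.comp (by fun_prop) fun r hr => ⟨hτ, hr⟩
  have htI : t ∈ Set.Icc 0 T := ⟨ht.1.le, ht.2.le⟩
  obtain ⟨C, hC⟩ := (isCompact_Icc.prod isCompact_Icc).exists_bound_of_continuousOn
    ((continuousOn_const (c := (2:ℝ))).mul (hfcont.mul hwcont))
  have hsub : Set.uIoc 0 b ⊆ Set.Icc 0 b := by
    rw [Set.uIoc_of_le hb.le]
    exact Set.Ioc_subset_Icc_self
  have hmeas : ∀ {h : ℝ → ℝ}, ContinuousOn h (Set.Icc 0 b) →
      AEStronglyMeasurable h (volume.restrict (Set.uIoc 0 b)) := fun hh =>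
    (hh.mono hsub).aestronglyMeasurable measurableSet_uIoc
  refine ⟨fun r => w (t, r), hslice t htI w hwcont, hderiv t ht, ?_⟩
  have key := hasDerivAt_integral_of_dominated_loc_of_deriv_le (μ := volume) (a := 0) (b := b)
    (F := fun τ r => u τ r ^ 2) (F' := fun τ r => 2 * (u τ r * w (τ, r))) (x₀ := t)
    (s := Set.Ioo 0 T) (bound := fun _ => C) (Ioo_mem_nhds ht.1 ht.2) ?_ ?_ ?_ ?_ ?_ ?_
  · rw [← intervalIntegral.integral_const_mul]
    exact key.2
  · filter_upwards [Ioo_mem_nhds ht.1 ht.2] with τ hτ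
    exact hmeas ((hslice τ ⟨hτ.1.le, hτ.2.le⟩ f hfcont).pow 2)
  · refine ContinuousOn.intervalIntegrable ?_
    rw [Set.uIcc_of_le hb.le]
    exact (hslice t htI f hfcont).pow 2
  · exact hmeas (continuousOn_const.mul
      ((hslice t htI f hfcont).mul (hslice t htI w hwcont)))
  · exact Filter.Eventually.of_forall fun r hr τ hτ =>
      hC (τ, r) ⟨⟨hτ.1.le, hτ.2.le⟩, hsub hr⟩
  · exact intervalIntegrable_const
  · refine Filter.Eventually.of_forall fun r hr τ hτ => ?_
    refine ((hderiv τ hτ r (hsub hr)).pow 2).congr_deriv ?_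
    norm_num [mul_assoc]

/-- Continuous-level L²-energy inequality (Theorem 3.1) for the spherically
symmetric Einstein--scalar system in Bondi gauge:
`(1/2) d/dt ‖u(t)‖² + (1/4) g(t,0) u(t,0)² ≤ (1/4) U_b(t)² + (1/4)(1 - g(t,0))`. -/
theorem stmt13 (b T : ℝ) (hb : 0 < b) (hT : 0 < T)
    (Ub : ℝ → ℝ) (hUb : ContinuousOn Ub (Set.Icc 0 T))
    (u tu g tg : ℝ → ℝ → ℝ)
    (hu : ContDiffOn ℝ 1 (fun p : ℝ × ℝ => u p.1 p.2) (Set.Icc 0 T ×ˢ Set.Icc 0 b))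
    (htu : ∀ t ∈ Set.Icc 0 T, ∀ r ∈ Set.Ioc 0 b,
      tu t r = (1 / r) * ∫ s in (0:ℝ)..r, u t s)
    (htu0 : ∀ t ∈ Set.Icc 0 T, tu t 0 = u t 0)
    (hg : ∀ t ∈ Set.Icc 0 T, ∀ r ∈ Set.Icc 0 b,
      g t r = Real.exp (-(∫ s in r..b, (1 / s) * (u t s - tu t s) ^ 2)))
    (htg : ∀ t ∈ Set.Icc 0 T, ∀ r ∈ Set.Ioc 0 b,
      tg t r = (1 / r) * ∫ s in (0:ℝ)..r, g t s)
    (hPDE : ∀ t ∈ Set.Ioo 0 T, ∀ r ∈ Set.Ioo 0 b,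
      HasDerivAt (fun τ => u τ r)
        (deriv (fun x => (1 / 2) * tg t x * u t x) r
          - (1 / 2) * deriv (fun x => tg t x) r * tu t r) t)
    (hub : ∀ t ∈ Set.Icc 0 T, u t b = Ub t) :
    ∀ t ∈ Set.Ioo 0 T,
      (1 / 2) * deriv (fun τ => ∫ r in (0:ℝ)..b, (u τ r) ^ 2) t
        + (1 / 4) * g t 0 * (u t 0) ^ 2
      ≤ (1 / 4) * (Ub t) ^ 2 + (1 / 4) * (1 - g t 0) := by
  intro t ht
  have htI : t ∈ Set.Icc 0 T := ⟨ht.1.le, ht.2.le⟩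
  obtain ⟨p, hp, hdp, hE⟩ := exists_hasDerivAt_integral_sq hb hT hu ht
  have hv : ContDiffOn ℝ 1 (u t) (Set.Icc 0 b) :=
    hu.comp (f := fun r : ℝ => (t, r)) (by fun_prop) fun r hr => ⟨htI, hr⟩
  have h := integral_mul_le_of_bondi_slice hb hv (htu t htI) (hg t htI) (htg t htI) hp
    fun r hr => (hdp r ⟨hr.1.le, hr.2.le⟩).unique (hPDE t ht r hr)
  rw [hE.deriv, ← hub t htI]
  linarith
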